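/- Let n ≥ 2 and let A be a unital prime associative algebra over a commutative unital ring R (i.e., for all a, b ∈ A, if axb = 0 for every x ∈ A then a = 0 or b = 0) that is 2-torsion free and (n−1)-torsion free, with a nontrivial idempotent e and f = 1 − e. Suppose at least one of: (i-1) eAe = S(eAe) and fAf = S(fAf); (i-2) eAe = S(eAe) and Z(eAe) = eZ(A)e; (i-3) fAf = S(fAf) and Z(fAf) = fZ(A)f; (i-4) Z(eAe) = eZ(A)e and Z(fAf) = fZ(A)f. Suppose also at least one of: (ii-1) eAe or fAf is noncommutative; (ii-2) eAe or fAf has no nonzero central ideal; (ii-3) there exists m₀ ∈ eAf with Z(A) = {a + b : a ∈ eZ(A)e, b ∈ fZ(A)f, am₀ = m₀b}; (ii-4) there exists t₀ ∈ fAe with Z(A) = {a + b : a ∈ eZ(A)e, b ∈ fZ(A)f, t₀a = bt₀}; (ii-5) eAf·fAe = {0} and fAe·eAf = {0}. Then every Lie n-derivation on A is standard. -/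

import Mathlib

open Finset

/-- Iterated commutator: `pCom x k = p_{k+1}(x 0, ..., x k)`, i.e.
`pCom x 0 = x 0` and `pCom x (k+1) = [pCom x k, x (k+1)]`. -/
def pCom {A : Type*} [Ring A] (x : ℕ → A) : ℕ → A
  | 0 => x 0
  | k + 1 => pCom x k * x (k + 1) - x (k + 1) * pCom x k

/-- `φ` is a Lie `n`-derivation. -/
def IsLieNDeriv {R : Type*} {A : Type*} [CommRing R] [Ring A] [Algebra R A]
    (n : ℕ) (φ : A →ₗ[R] A) : Prop :=
  ∀ x : ℕ → A,
    φ (pCom x (n - 1)) =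
      ∑ i ∈ Finset.range n, pCom (Function.update x i (φ (x i))) (n - 1)

/-- `d` is a derivation. -/
def IsDeriv {R : Type*} {A : Type*} [CommRing R] [Ring A] [Algebra R A]
    (d : A →ₗ[R] A) : Prop :=
  ∀ x y : A, d (x * y) = d x * y + x * d y

/-- `δ` is a Jordan derivation. -/
def IsJordanDeriv {R : Type*} {A : Type*} [CommRing R] [Ring A] [Algebra R A]
    (δ : A →ₗ[R] A) : Prop :=
  ∀ x y : A, δ (x * y + y * x) = δ x * y + y * δ x + x * δ y + δ y * x

/-- `δ` is an antiderivation. -/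
def IsAntiDeriv {R : Type*} {A : Type*} [CommRing R] [Ring A] [Algebra R A]
    (δ : A →ₗ[R] A) : Prop :=
  ∀ x y : A, δ (x * y) = δ y * x + y * δ x

/-- `δ` is a singular Jordan derivation relative to the idempotent `e`
(with `f = 1 - e`): it is a Jordan derivation killing `eAe` and `fAf`,
mapping `eAf` into `fAe` and `fAe` into `eAf`. -/
def IsSingularJordanDeriv {R : Type*} {A : Type*} [CommRing R] [Ring A] [Algebra R A]
    (e : A) (δ : A →ₗ[R] A) : Prop :=
  IsJordanDeriv δ ∧
  (∀ a : A, δ (e * a * e) = 0) ∧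
  (∀ b : A, δ ((1 - e) * b * (1 - e)) = 0) ∧
  (∀ m : A, δ (e * m * (1 - e)) = (1 - e) * δ (e * m * (1 - e)) * e) ∧
  (∀ t : A, δ ((1 - e) * t * e) = e * δ ((1 - e) * t * e) * (1 - e))

/-- `z` is a central element. -/
def IsCent {A : Type*} [Ring A] (z : A) : Prop := ∀ y : A, z * y = y * z

/-- The centre of `A` as a set. -/
def centerSet (A : Type*) [Ring A] : Set A := {z : A | ∀ y : A, z * y = y * z}

/-- `γ` vanishes on all `(n-1)`-th commutators. -/
def VanishesOnNCommutators {R : Type*} {A : Type*} [CommRing R] [Ring A] [Algebra R A]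
    (n : ℕ) (γ : A →ₗ[R] A) : Prop :=
  ∀ x : ℕ → A, γ (pCom x (n - 1)) = 0

/-- A Lie `n`-derivation is standard if it is the sum of a derivation and a
central-valued map vanishing on all `(n-1)`-th commutators. -/
def IsStandardLieNDeriv {R : Type*} {A : Type*} [CommRing R] [Ring A] [Algebra R A]
    (n : ℕ) (φ : A →ₗ[R] A) : Prop :=
  ∃ d γ : A →ₗ[R] A,
    IsDeriv d ∧ (∀ x : A, IsCent (γ x)) ∧ VanishesOnNCommutators n γ ∧ φ = d + γ

/-- Property (Q) for the idempotent `e` (with `f = 1 - e`):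
`exe·eAf = 0 = fAe·exe` implies `exe = 0`, and
`eAf·fxf = 0 = fxf·fAe` implies `fxf = 0`. -/
def PropQ {A : Type*} [Ring A] (e : A) : Prop :=
  (∀ x : A,
    ((∀ y : A, (e * x * e) * (e * y * (1 - e)) = 0) ∧
     (∀ y : A, ((1 - e) * y * e) * (e * x * e) = 0)) → e * x * e = 0) ∧
  (∀ x : A,
    ((∀ y : A, (e * y * (1 - e)) * ((1 - e) * x * (1 - e)) = 0) ∧
     (∀ y : A, ((1 - e) * x * (1 - e)) * ((1 - e) * y * e) = 0)) →
        (1 - e) * x * (1 - e) = 0)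

/-- `A` is `k`-torsion free. -/
def TorsionFreeAt (A : Type*) [Ring A] (k : ℕ) : Prop :=
  ∀ x : A, k • x = 0 → x = 0

/-- The centre of the corner algebra `gAg` (for an idempotent `g`). -/
def cornerCenter {A : Type*} [Ring A] (g : A) : Set A :=
  {z : A | z = g * z * g ∧ ∀ a : A, z * (g * a * g) = (g * a * g) * z}

/-- The corner algebra `gAg` has no nonzero central ideal: every
ideal of `gAg` consisting of elements central in `gAg` is zero. -/
def NoNonzeroCentralIdeal (R : Type*) [CommRing R] (A : Type*) [Ring A] [Algebra R A]
    (g : A) : Prop :=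
  ∀ I : Set A, (0 : A) ∈ I →
    (∀ x ∈ I, x = g * x * g) →
    (∀ x ∈ I, ∀ y ∈ I, x + y ∈ I) →
    (∀ r : R, ∀ x ∈ I, r • x ∈ I) →
    (∀ x ∈ I, ∀ a : A, (g * a * g) * x ∈ I) →
    (∀ x ∈ I, ∀ a : A, x * (g * a * g) ∈ I) →
    (∀ x ∈ I, ∀ a : A, x * (g * a * g) = (g * a * g) * x) →
    ∀ x ∈ I, x = 0

/-- The generating set of `S(gAg)`: all idempotents of `gAg` together with all
commutators of elements of `gAg`. -/
def cornerGenSet {A : Type*} [Ring A] (g : A) : Set A :=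
  {x : A | x = g * x * g ∧ x * x = x} ∪
  {x : A | ∃ a b : A, x = (g * a * g) * (g * b * g) - (g * b * g) * (g * a * g)}

/-- `gAg = S(gAg)`: the corner algebra is generated (as an algebra) by its
idempotents and commutators. -/
def CornerGenerated (R : Type*) [CommRing R] {A : Type*} [Ring A] [Algebra R A]
    (g : A) : Prop :=
  ∀ x : A, g * x * g ∈ NonUnitalAlgebra.adjoin R (cornerGenSet g)

/-- Condition (*) for the corner algebra `gAg`: if `[x, gAg] ⊆ Z(gAg)` then
`x ∈ Z(gAg)`. -/
def CornerCondStar {A : Type*} [Ring A] (g : A) : Prop :=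
  ∀ x : A, x = g * x * g →
    (∀ a : A, x * (g * a * g) - (g * a * g) * x ∈ cornerCenter g) →
    x ∈ cornerCenter g


section PeirceDecomposition

variable {R A : Type*} [CommRing R] [Ring A] [Algebra R A]

/-- A pair of nonzero complementary idempotents in a prime ring. -/
structure PrimePair (e f : A) : Prop where
  prime : ∀ a b : A, (∀ x : A, a * x * b = 0) → a = 0 ∨ b = 0
  left_ne : e ≠ 0
  right_ne : f ≠ 0
  ee : e * e = e
  ff : f * f = f
  ef : e * f = 0
  fe : f * e = 0
  sum : e + f = 1

/-- `x` lies in the Peirce component `gAh`. -/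
def InCorner (g h x : A) : Prop := g * x = x ∧ x * h = x

/-- The iterate of the map `u ↦ [u, g]`. -/
def adIter (g : A) (k : ℕ) : A → A := (fun u => ⁅u, g⁆)^[k]

lemma adIter_succ (g : A) (k : ℕ) (u : A) : adIter g (k + 1) u = ⁅adIter g k u, g⁆ := by
  simp [adIter, Function.iterate_succ_apply']

lemma adIter_lie (g : A) (k : ℕ) (u : A) : adIter g k ⁅u, g⁆ = adIter g (k + 1) u := by
  simp [adIter, Function.iterate_succ_apply]

lemma adIter_zero_right (g : A) (k : ℕ) : adIter g k (0 : A) = 0 := by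
  induction k with
  | zero => rfl
  | succ k ih => rw [adIter_succ, ih, Ring.lie_def, zero_mul, mul_zero, sub_zero]

lemma mul_reassoc {a b c : A} (h : a * b = c) (x : A) : a * (b * x) = c * x := by
  rw [← mul_assoc, h]

lemma IsCent.lie_eq {z : A} (hz : IsCent z) (x : A) : ⁅z, x⁆ = 0 := by
  rw [Ring.lie_def, hz x, sub_self]

lemma IsCent.lie_eq' {z : A} (hz : IsCent z) (x : A) : ⁅x, z⁆ = 0 := by
  rw [Ring.lie_def, hz x, sub_self]

lemma IsCent.add {z w : A} (hz : IsCent z) (hw : IsCent w) : IsCent (z + w) := fun y => by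
  rw [add_mul, mul_add, hz, hw]

lemma IsCent.sub {z w : A} (hz : IsCent z) (hw : IsCent w) : IsCent (z - w) := fun y => by
  rw [sub_mul, mul_sub, hz, hw]

lemma IsCent.smul {z : A} (r : R) (hz : IsCent z) : IsCent (r • z) := fun y => by
  rw [smul_mul_assoc, mul_smul_comm, hz]

lemma isCent_zero : IsCent (0 : A) := fun y => by simp

lemma isCent_one : IsCent (1 : A) := fun y => by simp

lemma IsCent.mul_comm_of_comm {z x y : A} (hz : IsCent z) (h : x * y = y * x) :
    z * x * y = y * (z * x) := by
  rw [mul_assoc, h, ← mul_assoc, hz y, mul_assoc]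

namespace InCorner

variable {g h i j x y : A}

lemma add (hx : InCorner g h x) (hy : InCorner g h y) : InCorner g h (x + y) :=
  ⟨by rw [mul_add, hx.1, hy.1], by rw [add_mul, hx.2, hy.2]⟩

lemma sub (hx : InCorner g h x) (hy : InCorner g h y) : InCorner g h (x - y) :=
  ⟨by rw [mul_sub, hx.1, hy.1], by rw [sub_mul, hx.2, hy.2]⟩

lemma neg (hx : InCorner g h x) : InCorner g h (-x) :=
  ⟨by rw [mul_neg, hx.1], by rw [neg_mul, hx.2]⟩

lemma mul (hx : InCorner g h x) (hy : InCorner i j y) : InCorner g j (x * y) :=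
  ⟨by rw [← mul_assoc, hx.1], by rw [mul_assoc, hy.2]⟩

lemma mul_eq_zero (hx : InCorner g h x) (hy : InCorner i j y) (hi : h * i = 0) : x * y = 0 := by
  rw [← hx.2, ← hy.1, mul_assoc, ← mul_assoc h, hi, zero_mul, mul_zero]

lemma left_eq_zero (hx : InCorner g h x) (hi : i * g = 0) : i * x = 0 := by
  rw [← hx.1, ← mul_assoc, hi, zero_mul]

lemma right_eq_zero (hx : InCorner g h x) (hi : h * i = 0) : x * i = 0 := by
  rw [← hx.2, mul_assoc, hi, mul_zero]

end InCorner

namespace PrimePair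

variable {e f : A}

lemma symm (h : PrimePair e f) : PrimePair f e where
  prime := h.prime
  left_ne := h.right_ne
  right_ne := h.left_ne
  ee := h.ff
  ff := h.ee
  ef := h.fe
  fe := h.ef
  sum := by rw [add_comm]; exact h.sum

lemma corner₁₁ (h : PrimePair e f) (x : A) : InCorner e e (e * x * e) :=
  ⟨by rw [← mul_assoc, ← mul_assoc, h.ee], by rw [mul_assoc _ e e, h.ee]⟩

lemma corner₁₂ (h : PrimePair e f) (x : A) : InCorner e f (e * x * f) :=
  ⟨by rw [← mul_assoc, ← mul_assoc, h.ee], by rw [mul_assoc _ f f, h.ff]⟩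

lemma decomp (h : PrimePair e f) (x : A) :
    x = e * x * e + e * x * f + f * x * e + f * x * f := by
  have : x = (e + f) * x * (e + f) := by rw [h.sum, one_mul, mul_one]
  nth_rewrite 1 [this]
  noncomm_ring

lemma eq_zero_of_parts (h : PrimePair e f) {x : A} (h1 : e * x * e = 0) (h2 : e * x * f = 0)
    (h3 : f * x * e = 0) (h4 : f * x * f = 0) : x = 0 := by
  rw [h.decomp x, h1, h2, h3, h4]; simp

lemma loyal_left (h : PrimePair e f) {a : A} (ha : ∀ m, InCorner e f m → a * m = 0) :
    a * e = 0 := by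
  refine (h.prime (a * e) f fun x => ?_).resolve_right h.right_ne
  have := ha _ (h.corner₁₂ x)
  rw [← this]; noncomm_ring

lemma loyal_right (h : PrimePair e f) {b : A} (hb : ∀ m, InCorner e f m → m * b = 0) :
    f * b = 0 := by
  refine (h.prime e (f * b) fun x => ?_).resolve_left h.left_ne
  have := hb _ (h.corner₁₂ x)
  rw [← this]; noncomm_ring

/-- A nonzero central element of a prime ring is not a zero divisor. -/
lemma cent_mul (h : PrimePair e f) {z x : A} (hz : IsCent z) (hzx : z * x = 0) :
    z = 0 ∨ x = 0 :=
  h.prime z x fun y => by rw [hz, mul_assoc, hzx, mul_zero]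

lemma isCent_of_comm (h : PrimePair e f) {u : A} (hu : u * f = f * u)
    (hm : ∀ m, InCorner e f m → u * m = m * u) : IsCent u := by
  have hue : u * e = e * u := by
    have he : e = 1 - f := by rw [← h.sum]; abel
    rw [he, mul_sub, sub_mul, hu, mul_one, one_mul]
  have key : ∀ y, e * (u * y - y * u) * e = 0 := by
    intro y
    have := h.loyal_left (a := e * (u * y - y * u)) fun m hmm => by
      have h1 := hm (e * y * m) ⟨by rw [← mul_assoc, ← mul_assoc, h.ee], by rw [mul_assoc, hmm.2]⟩
      rw [mul_assoc, sub_mul, mul_assoc y u m, hm m hmm, mul_sub, ← mul_assoc e (u * y),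
        ← mul_assoc e u, ← hue, sub_eq_zero]
      simpa [mul_assoc] using h1
    exact this
  have key2 : ∀ y, e * (u * y - y * u) * f = 0 := by
    intro y
    have h1 := hm _ (h.corner₁₂ y)
    rw [mul_sub, sub_mul, ← mul_assoc e u, ← hue, mul_assoc e (y * u) f, mul_assoc y u f, hu,
      sub_eq_zero]
    simpa [mul_assoc] using h1
  have hmy : ∀ y m, InCorner e f m → m * (u * y - y * u) = e * (u * (m * y) - m * y * u) := by
    intro y m hmm
    rw [mul_sub, ← mul_assoc m u y, ← hm m hmm, mul_sub, ← mul_assoc e u, ← hue, mul_assoc u e,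
      ← mul_assoc e m y, hmm.1, ← mul_assoc e _ u, ← mul_assoc e m y, hmm.1]
    simp [mul_assoc]
  intro y
  rw [← sub_eq_zero]
  refine h.eq_zero_of_parts (key y) (key2 y) ?_ ?_
  · rw [mul_assoc]
    refine h.loyal_right fun m hmm => ?_
    rw [← mul_assoc, hmy y m hmm, key]
  · rw [mul_assoc]
    refine h.loyal_right fun m hmm => ?_
    rw [← mul_assoc, hmy y m hmm, key2]

section adIter

lemma lie_right₁₂ (h : PrimePair e f) {m : A} (hm : InCorner e f m) : ⁅m, f⁆ = m := by
  rw [Ring.lie_def, hm.2, hm.left_eq_zero h.fe, sub_zero]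

lemma adIter₁₂ (h : PrimePair e f) {m : A} (hm : InCorner e f m) (k : ℕ) : adIter f k m = m := by
  induction k with
  | zero => rfl
  | succ k ih => rw [adIter_succ, ih, h.lie_right₁₂ hm]

lemma mul_adIter_mul (h : PrimePair e f) (k : ℕ) (u : A) : e * adIter f k u * f = e * u * f := by
  induction k with
  | zero => rfl
  | succ k ih =>
    rw [adIter_succ, Ring.lie_def, ← ih, mul_sub, sub_mul, ← mul_assoc e f, h.ef, mul_assoc e,
      mul_assoc _ f f, h.ff]
    simp [mul_assoc]

lemma mul_adIter_mul' (h : PrimePair e f) (k : ℕ) (u : A) :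
    f * adIter f k u * e = (-1) ^ k * (f * u * e) := by
  induction k with
  | zero => simp [adIter]
  | succ k ih =>
    rw [adIter_succ, Ring.lie_def, pow_succ', mul_assoc (-1), ← ih, mul_sub, sub_mul,
      ← mul_assoc f f, h.ff, mul_assoc f, mul_assoc _ f e, h.fe]
    simp

lemma mul_lie_mul_left (h : PrimePair e f) (u : A) : e * ⁅u, f⁆ * e = 0 := by
  rw [Ring.lie_def, mul_sub, sub_mul, ← mul_assoc e f, h.ef, mul_assoc e, mul_assoc _ f e, h.fe]
  simp

lemma mul_lie_mul_right (h : PrimePair e f) (u : A) : f * ⁅u, f⁆ * f = 0 := by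
  rw [Ring.lie_def, mul_sub, sub_mul, ← mul_assoc f f, h.ff, mul_assoc f, mul_assoc _ f f, h.ff]
  simp [mul_assoc]

end adIter

end PrimePair

section pCom

lemma pCom_succ (s : ℕ → A) (k : ℕ) : pCom s (k + 1) = ⁅pCom s k, s (k + 1)⁆ := rfl

lemma pCom_congr {s t : ℕ → A} {k : ℕ} (h : ∀ i ≤ k, s i = t i) : pCom s k = pCom t k := by
  induction k with
  | zero => exact h 0 le_rfl
  | succ k ih => rw [pCom_succ, pCom_succ, h _ le_rfl, ih fun i hi => h i (by omega)]

lemma pCom_eq_adIter {s : ℕ → A} {g : A} {j : ℕ} (hs : ∀ i, j < i → s i = g) (k : ℕ) :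
    pCom s (j + k) = adIter g k (pCom s j) := by
  induction k with
  | zero => rfl
  | succ k ih => rw [← add_assoc, pCom_succ, ih, adIter_succ, hs _ (by omega)]

lemma pCom_eq_zero {s : ℕ → A} {i k : ℕ} (hs : IsCent (s i)) (hi : i ≤ k) (hk : 1 ≤ k) :
    pCom s k = 0 := by
  induction k with
  | zero => omega
  | succ k ih =>
    rw [pCom_succ]
    rcases Nat.lt_or_ge k i with h | h
    · obtain rfl : i = k + 1 := by omega
      exact hs.lie_eq' _
    · rcases Nat.eq_zero_or_pos k with rfl | h0
      · obtain rfl : i = 0 := by omega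
        exact hs.lie_eq _
      · rw [ih h h0, Ring.lie_def, zero_mul, mul_zero, sub_zero]

lemma IsDeriv.lie {d : A →ₗ[R] A} (hd : IsDeriv d) (x y : A) :
    d ⁅x, y⁆ = ⁅d x, y⁆ + ⁅x, d y⁆ := by
  simp only [Ring.lie_def, map_sub, hd x y, hd y x]; abel

lemma pCom_deriv {d : A →ₗ[R] A} (hd : ∀ x y, d ⁅x, y⁆ = ⁅d x, y⁆ + ⁅x, d y⁆) (s : ℕ → A) (k : ℕ) :
    d (pCom s k) = ∑ i ∈ Finset.range (k + 1), pCom (Function.update s i (d (s i))) k := by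
  induction k with
  | zero => simp [pCom]
  | succ k ih =>
    have hk : pCom (Function.update s (k + 1) (d (s (k + 1)))) k = pCom s k :=
      pCom_congr fun i hi => Function.update_of_ne (by omega) _ _
    rw [pCom_succ, hd, ih, Finset.sum_range_succ _ (k + 1), pCom_succ, Function.update_self, hk]
    congr 1
    rw [Ring.lie_def, Finset.sum_mul, Finset.mul_sum, ← Finset.sum_sub_distrib]
    refine Finset.sum_congr rfl fun i hi => ?_
    rw [pCom_succ, Function.update_of_ne (by simp at hi; omega), Ring.lie_def]

lemma isLieNDeriv_of_lie {d : A →ₗ[R] A} (hd : ∀ x y, d ⁅x, y⁆ = ⁅d x, y⁆ + ⁅x, d y⁆) {n : ℕ}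
    (hn : 1 ≤ n) : IsLieNDeriv n d := by
  intro s
  obtain ⟨k, rfl⟩ : ∃ k, n = k + 1 := ⟨n - 1, by omega⟩
  exact pCom_deriv hd s k

lemma pCom_update_add (s : ℕ → A) (i k : ℕ) (a b : A) (hi : i ≤ k) :
    pCom (Function.update s i (a + b)) k =
      pCom (Function.update s i a) k + pCom (Function.update s i b) k := by
  induction k with
  | zero => obtain rfl : i = 0 := by omega
            simp [pCom]
  | succ k ih =>
    rw [pCom_succ, pCom_succ, pCom_succ]
    rcases Nat.lt_or_ge k i with h | h
    · obtain rfl : i = k + 1 := by omega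
      have : ∀ c, pCom (Function.update s (k + 1) c) k = pCom s k := fun c =>
        pCom_congr fun i hi => Function.update_of_ne (by omega) _ _
      simp only [this, Function.update_self, Ring.lie_def, mul_add, add_mul]; abel
    · have : ∀ c, Function.update s i c (k + 1) = s (k + 1) := fun c =>
        Function.update_of_ne (by omega) _ _
      simp only [this, ih h, Ring.lie_def, mul_add, add_mul]; abel

lemma IsLieNDeriv.sub {φ d : A →ₗ[R] A} {n : ℕ} (hφ : IsLieNDeriv n φ) (hd : IsLieNDeriv n d) :
    IsLieNDeriv n (φ - d) := by
  intro s
  have h : (φ - d) (pCom s (n - 1)) + d (pCom s (n - 1)) = φ (pCom s (n - 1)) := by simp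
  rw [hφ s, hd s] at h
  rw [← add_left_inj, h, ← Finset.sum_add_distrib]
  refine Finset.sum_congr rfl fun i hi => ?_
  rw [← pCom_update_add _ _ _ _ _ (by simp at hi; omega)]
  simp

/-- The identity obtained from a Lie `n`-derivation by filling all but the first three slots of
the commutator with an element that is sent to the centre. -/
def TailLie (g : A) (k : ℕ) (φ : A →ₗ[R] A) : Prop :=
  ∀ x y z : A, φ (adIter g k ⁅⁅x, y⁆, z⁆) =
    adIter g k ⁅⁅φ x, y⁆, z⁆ + adIter g k ⁅⁅x, φ y⁆, z⁆ + adIter g k ⁅⁅x, y⁆, φ z⁆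

/-- The sequence `x, y, z, g, g, …`. -/
def tailSeq (g x y z : A) : ℕ → A
  | 0 => x
  | 1 => y
  | 2 => z
  | _ + 3 => g

lemma pCom_tailSeq_update {g x y z : A} (k i : ℕ) (hi : i < 3) (c : A) :
    pCom (Function.update (tailSeq g x y z) i c) (k + 2) =
      adIter g k (pCom (Function.update (tailSeq g x y z) i c) 2) := by
  rw [add_comm k 2]
  refine pCom_eq_adIter (fun j hj => ?_) k
  rw [Function.update_of_ne (by omega)]
  obtain ⟨l, rfl⟩ : ∃ l, j = l + 3 := ⟨j - 3, by omega⟩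
  rfl

lemma IsLieNDeriv.tailLie {φ : A →ₗ[R] A} {k : ℕ} (hφ : IsLieNDeriv (k + 3) φ) {g : A}
    (hg : IsCent (φ g)) : TailLie g k φ := by
  intro x y z
  have h := hφ (tailSeq g x y z)
  rw [show k + 3 - 1 = k + 2 from rfl, add_comm k 3, Finset.sum_range_add,
    Finset.sum_eq_zero (s := Finset.range k), add_zero] at h
  · have h0 : pCom (tailSeq g x y z) (k + 2) = adIter g k ⁅⁅x, y⁆, z⁆ := by
      have := pCom_tailSeq_update (g := g) (x := x) (y := y) (z := z) k 0 (by omega) x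
      have hs : Function.update (tailSeq g x y z) 0 x = tailSeq g x y z :=
        Function.update_eq_self 0 _
      rw [hs] at this
      exact this
    rw [h0] at h
    rw [h, Finset.sum_range_succ, Finset.sum_range_succ, Finset.sum_range_one,
      pCom_tailSeq_update k 0 (by omega), pCom_tailSeq_update k 1 (by omega),
      pCom_tailSeq_update k 2 (by omega)]
    rfl
  · intro i hi
    refine pCom_eq_zero (i := 3 + i) ?_ (by simp at hi; omega) (by omega)
    rw [Function.update_self, add_comm 3 i]
    exact hg

end pCom

namespace PrimePair

variable {e f : A}

lemma comm_of_parts (h : PrimePair e f) {u : A} (h1 : e * u * f = 0) (h2 : f * u * e = 0) :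
    u * f = f * u := by
  have e1 : u * f = (e + f) * u * f := by rw [h.sum, one_mul]
  have e2 : f * u = f * u * (e + f) := by rw [h.sum, mul_one]
  rw [e1, e2, add_mul, add_mul, mul_add, h1, h2, zero_add]

lemma comm_symm (h : PrimePair e f) {u : A} (hu : u * f = f * u) : u * e = e * u := by
  have he : e = 1 - f := by rw [← h.sum]; abel
  rw [he, mul_sub, sub_mul, hu, mul_one, one_mul]

lemma comm_of_lie_parts (h : PrimePair e f) {u : A} (h1 : e * ⁅u, f⁆ * f = 0)
    (h2 : f * ⁅u, f⁆ * e = 0) : u * f = f * u := by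
  refine h.comm_of_parts ?_ ?_
  · rw [← h1, Ring.lie_def, mul_sub, sub_mul, ← mul_assoc e f, h.ef, mul_assoc e (u * f),
      mul_assoc u f f, h.ff]
    simp [mul_assoc]
  · rw [← neg_eq_zero, ← h2, Ring.lie_def, mul_sub, sub_mul, ← mul_assoc f f, h.ff,
      mul_assoc f (u * f), mul_assoc u f e, h.fe]
    simp

lemma parts_of_adIter_eq_zero (h : PrimePair e f) {k : ℕ} {v : A} (hv : adIter f k v = 0) :
    e * v * f = 0 ∧ f * v * e = 0 := by
  constructor
  · rw [← h.mul_adIter_mul k, hv]; simp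
  · have := h.mul_adIter_mul' k v
    rw [hv, mul_zero, zero_mul] at this
    rcases neg_one_pow_eq_or A k with hk | hk <;> rw [hk] at this
    · simpa using this.symm
    · simpa using this.symm

lemma lie_mem₁₂ (h : PrimePair e f) {x m : A} (hx : x * f = f * x) (hm : InCorner e f m) :
    InCorner e f ⁅x, m⁆ := by
  have hx' := h.comm_symm hx
  constructor
  · rw [Ring.lie_def, mul_sub, ← mul_assoc, ← hx', mul_assoc, hm.1, ← mul_assoc, hm.1]
  · rw [Ring.lie_def, sub_mul, mul_assoc, hm.2, mul_assoc, hx, ← mul_assoc, hm.2]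

lemma lie_eq_zero_of_adIter (h : PrimePair e f) {k : ℕ} {x m : A} (hx : x * f = f * x)
    (hm : InCorner e f m) (hv : adIter f k ⁅x, m⁆ = 0) : x * m = m * x := by
  rw [h.adIter₁₂ (h.lie_mem₁₂ hx hm), Ring.lie_def, sub_eq_zero] at hv
  exact hv

lemma isCent_map_one (h : PrimePair e f) {φ : A →ₗ[R] A} {k : ℕ}
    (hφ : IsLieNDeriv (k + 3) φ) : IsCent (φ 1) := by
  have key : ∀ y, adIter f (k + 1) ⁅φ 1, y⁆ = 0 := by
    intro y
    have h1 := hφ (tailSeq f 1 y f)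
    rw [show k + 3 - 1 = k + 2 from rfl, Finset.sum_range_succ', pCom_tailSeq_update k 0 (by omega),
      Finset.sum_eq_zero, pCom_eq_zero (i := 0) isCent_one (by omega) (by omega), map_zero,
      zero_add] at h1
    · rw [← adIter_lie]; exact h1.symm
    · intro i hi
      refine pCom_eq_zero (i := 0) ?_ (by omega) (by omega)
      rw [Function.update_of_ne (by omega)]
      exact isCent_one
  have h1 := h.parts_of_adIter_eq_zero (key f)
  have h2 := h.comm_of_lie_parts h1.1 h1.2
  exact h.isCent_of_comm h2 fun m hm => h.lie_eq_zero_of_adIter h2 hm (key m)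

lemma pCom_update_right (h : PrimePair e f) {s : ℕ → A} {m w : A} (hs0 : s 0 = m)
    (hs : ∀ i, 0 < i → s i = f) (hm : InCorner e f m) (hw : w * f = f * w) {i k : ℕ}
    (hi : 0 < i) (hik : i ≤ k) : pCom (Function.update s i w) k = ⁅m, w⁆ := by
  have hmw : InCorner e f ⁅m, w⁆ := by
    have := (h.lie_mem₁₂ hw hm).neg
    rwa [Ring.lie_def, neg_sub] at this
  induction k with
  | zero => omega
  | succ k ih =>
    rw [pCom_succ]
    rcases Nat.lt_or_ge k i with hk | hk
    · obtain rfl : i = k + 1 := by omega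
      have h1 : pCom (Function.update s (k + 1) w) k = pCom s k :=
        pCom_congr fun i hi => Function.update_of_ne (by omega) _ _
      have h2 := pCom_eq_adIter (s := s) (j := 0) hs k
      rw [zero_add] at h2
      rw [h1, h2, Function.update_self, show pCom s 0 = m from hs0, h.adIter₁₂ hm]
    · rw [ih hk, Function.update_of_ne (by omega), hs _ (by omega), h.lie_right₁₂ hmw]

lemma isCent_map_right (h : PrimePair e f) {φ : A →ₗ[R] A} {k : ℕ}
    (hφ : IsLieNDeriv (k + 3) φ) (htor : TorsionFreeAt A (k + 2))
    (hf : φ f * f = f * φ f) : IsCent (φ f) := by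
  refine h.isCent_of_comm hf fun m hm => ?_
  have hs : ∀ i, 0 < i → tailSeq f m f f i = f := by
    intro i hi
    match i, hi with
    | 1, _ => rfl
    | 2, _ => rfl
    | i + 3, _ => rfl
  have h1 := hφ (tailSeq f m f f)
  have h2 := pCom_eq_adIter (s := tailSeq f m f f) (j := 0) hs (k + 2)
  have h3 := pCom_eq_adIter (s := Function.update (tailSeq f m f f) 0 (φ m)) (g := f) (j := 0)
    (fun i hi => by rw [Function.update_of_ne (by omega), hs i hi]) (k + 2)
  rw [zero_add] at h2 h3
  rw [show k + 3 - 1 = k + 2 from rfl, h2, show pCom (tailSeq f m f f) 0 = m from rfl,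
    h.adIter₁₂ hm, Finset.sum_range_succ', show tailSeq f m f f 0 = m from rfl, h3,
    Finset.sum_congr rfl (g := fun _ => ⁅m, φ f⁆), Finset.sum_const, Finset.card_range] at h1
  · have h4 : e * φ m * f = e * φ m * f + (k + 2) • ⁅m, φ f⁆ := by
      have hmw : InCorner e f ((k + 2) • ⁅m, φ f⁆) := by
        have := (h.lie_mem₁₂ hf hm).neg
        rw [Ring.lie_def, neg_sub] at this
        rw [Ring.lie_def]
        exact ⟨by rw [mul_smul_comm, this.1], by rw [smul_mul_assoc, this.2]⟩
      nth_rewrite 1 [h1]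
      rw [mul_add, add_mul, hmw.1, hmw.2, add_comm]
      congr 1
      rw [h.mul_adIter_mul]
      rfl
    have h5 := htor _ (left_eq_add.1 h4)
    rw [Ring.lie_def, sub_eq_zero] at h5
    exact h5.symm
  · intro i hi
    rw [hs _ (by omega)]
    exact h.pCom_update_right rfl hs hm hf (by omega) (by simp at hi; omega)

end PrimePair

/-- A Lie-type derivation normalised with respect to a pair of complementary idempotents. -/
structure NormalLie (e f : A) (k : ℕ) (φ : A →ₗ[R] A) : Prop where
  pair : PrimePair e f
  two : TorsionFreeAt A 2
  cent_left : IsCent (φ e)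
  cent_right : IsCent (φ f)
  tail_left : TailLie e k φ
  tail_right : TailLie f k φ

lemma TorsionFreeAt.eq_zero {x : A} (h : TorsionFreeAt A 2) (hx : x + x = 0) : x = 0 :=
  h x (by rw [two_smul, hx])

namespace NormalLie

variable {e f : A} {k : ℕ} {φ : A →ₗ[R] A}

lemma symm (H : NormalLie e f k φ) : NormalLie f e k φ :=
  ⟨H.pair.symm, H.two, H.cent_right, H.cent_left, H.tail_right, H.tail_left⟩

lemma map_comm (H : NormalLie e f k φ) {x : A} (hx : x * f = f * x) : φ x * f = f * φ x := by
  have h1 := H.tail_right x f f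
  have hxf : ⁅x, f⁆ = 0 := by rw [Ring.lie_def, hx, sub_self]
  have h0 : ∀ y : A, ⁅(0 : A), y⁆ = 0 := fun y => by rw [Ring.lie_def]; simp
  rw [hxf, H.cent_right.lie_eq', h0, h0, adIter_zero_right, map_zero, add_zero, add_zero,
    adIter_lie] at h1
  have h2 := H.pair.parts_of_adIter_eq_zero h1.symm
  exact H.pair.comm_of_lie_parts h2.1 h2.2

lemma adIter_map₁₂ (H : NormalLie e f k φ) {m : A} (hm : InCorner e f m) :
    adIter f (k + 2) (φ m) = φ m := by
  have h1 := H.tail_right m f f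
  have h0 : ∀ y : A, ⁅(0 : A), y⁆ = 0 := fun y => by rw [Ring.lie_def]; simp
  rw [H.cent_right.lie_eq', H.cent_right.lie_eq', h0, adIter_zero_right, add_zero, add_zero,
    H.pair.lie_right₁₂ hm, H.pair.lie_right₁₂ hm, H.pair.adIter₁₂ hm, adIter_lie, adIter_lie] at h1
  exact h1.symm

lemma map_lie_aux (H : NormalLie e f k φ) {x m : A} (hx : x * f = f * x)
    (hm : InCorner e f m) :
    φ ⁅x, m⁆ = adIter f (k + 1) ⁅φ x, m⁆ + adIter f (k + 1) ⁅x, φ m⁆ := by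
  have h1 := H.tail_right x m f
  rw [H.cent_right.lie_eq', adIter_zero_right, adIter_lie, adIter_lie, adIter_lie, add_zero,
    H.pair.adIter₁₂ (H.pair.lie_mem₁₂ hx hm)] at h1
  exact h1

lemma lie_comm (H : NormalLie e f k φ) {x y : A} (hx : InCorner e f x) (hy : InCorner f e y) :
    ⁅x, y⁆ * f = f * ⁅x, y⁆ := by
  have p := H.pair
  rw [Ring.lie_def, sub_mul, mul_sub, (hx.mul hy).right_eq_zero p.ef, (hx.mul hy).left_eq_zero p.fe,
    (hy.mul hx).2, (hy.mul hx).1]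

lemma map_part₂₁ (H : NormalLie e f k φ) {m : A} (hm : InCorner e f m) : f * φ m * e = 0 := by
  have p := H.pair
  set s := f * φ m * e with hs
  have hsc : InCorner f e s := p.symm.corner₁₂ _
  have h1 : s = (-1) ^ (k + 2) * s := by
    rw [hs]
    nth_rewrite 1 [← H.adIter_map₁₂ hm]
    rw [p.mul_adIter_mul']
  have hk2 : ((-1 : A)) ^ (k + 2) = (-1) ^ k := by rw [pow_add]; simp
  rw [hk2] at h1
  rcases neg_one_pow_eq_or A k with hk | hk
  swap
  · rw [hk, neg_one_mul] at h1
    exact H.two.eq_zero (by nth_rewrite 1 [h1]; simp)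
  have key : ∀ m', InCorner e f m' → s * m' * s = 0 := by
    intro m' hm'
    have hxc := H.lie_comm hm' hsc
    have hxe := p.comm_symm hxc
    have hX : f * ⁅⁅m', s⁆, φ m⁆ * e = ⁅⁅m', s⁆, s⁆ := by
      generalize ⁅m', s⁆ = x at hxc hxe
      have b1 : f * (x * φ m) * e = x * s := by rw [hs, ← mul_assoc, ← hxc]; noncomm_ring
      have b2 : f * (φ m * x) * e = s * x := by
        rw [hs, mul_assoc f, mul_assoc (φ m), hxe]; noncomm_ring
      rw [Ring.lie_def, Ring.lie_def, mul_sub, sub_mul, b1, b2]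
    have a1 : f * φ ⁅⁅m', s⁆, m⁆ * e = -⁅⁅m', s⁆, s⁆ := by
      have b0 := p.lie_mem₁₂ (H.map_comm hxc) hm
      rw [H.map_lie_aux hxc hm, p.adIter₁₂ b0, mul_add, add_mul, b0.left_eq_zero p.fe,
        p.mul_adIter_mul', hX, pow_succ, hk]
      simp
    have a2 : f * φ ⁅⁅m', s⁆, m⁆ * e = ⁅⁅m', s⁆, s⁆ := by
      have b : ∀ v : A, f * ⁅v, m⁆ * e = 0 := fun v => by
        rw [Ring.lie_def, mul_sub, sub_mul, ← mul_assoc f m, hm.left_eq_zero p.fe, mul_assoc f,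
          mul_assoc v, hm.right_eq_zero p.fe]
        simp
      have b0 := H.tail_right m' s m
      rw [p.adIter₁₂ (p.lie_mem₁₂ hxc hm)] at b0
      rw [b0, mul_add, mul_add, add_mul, add_mul, p.mul_adIter_mul', p.mul_adIter_mul',
        p.mul_adIter_mul', b, b, hk, hX]
      simp
    have a3 := H.two.eq_zero (x := ⁅⁅m', s⁆, s⁆) (by nth_rewrite 1 [← a2]; rw [a1]; simp)
    have hss : s * s = 0 := hsc.mul_eq_zero hsc p.ef
    rw [Ring.lie_def, Ring.lie_def, sub_mul, mul_sub, mul_assoc m', hss, ← mul_assoc s s, hss] at a3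
    refine H.two.eq_zero ?_
    rw [← neg_eq_zero, ← a3]
    noncomm_ring
  refine (or_self_iff.1 (p.prime s s fun x => ?_))
  have := key _ (p.corner₁₂ x)
  rw [← this]
  nth_rewrite 1 [← hsc.2]
  nth_rewrite 2 [← hsc.1]
  noncomm_ring

lemma map₁₂ (H : NormalLie e f k φ) {m : A} (hm : InCorner e f m) : InCorner e f (φ m) := by
  have p := H.pair
  have h1 : e * φ m * e = 0 := by
    rw [← H.adIter_map₁₂ hm, adIter_succ, p.mul_lie_mul_left]
  have h2 : f * φ m * f = 0 := by
    rw [← H.adIter_map₁₂ hm, adIter_succ, p.mul_lie_mul_right]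
  have h3 := p.decomp (φ m)
  rw [h1, h2, H.map_part₂₁ hm, zero_add, add_zero, add_zero] at h3
  rw [h3]
  exact p.corner₁₂ _

lemma map_lie (H : NormalLie e f k φ) {x m : A} (hx : x * f = f * x) (hm : InCorner e f m) :
    φ ⁅x, m⁆ = ⁅φ x, m⁆ + ⁅x, φ m⁆ := by
  rw [H.map_lie_aux hx hm, H.pair.adIter₁₂ (H.pair.lie_mem₁₂ (H.map_comm hx) hm),
    H.pair.adIter₁₂ (H.pair.lie_mem₁₂ hx (H.map₁₂ hm))]

lemma map_lie_lie (H : NormalLie e f k φ) {m t m' : A} (hm : InCorner e f m)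
    (ht : InCorner f e t) (hm' : InCorner e f m') :
    φ ⁅⁅m, t⁆, m'⁆ = ⁅⁅φ m, t⁆, m'⁆ + ⁅⁅m, φ t⁆, m'⁆ + ⁅⁅m, t⁆, φ m'⁆ := by
  have p := H.pair
  have h := H.tail_right m t m'
  rwa [p.adIter₁₂ (p.lie_mem₁₂ (H.lie_comm hm ht) hm'),
    p.adIter₁₂ (p.lie_mem₁₂ (H.lie_comm (H.map₁₂ hm) ht) hm'),
    p.adIter₁₂ (p.lie_mem₁₂ (H.lie_comm hm (H.symm.map₁₂ ht)) hm'),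
    p.adIter₁₂ (p.lie_mem₁₂ (H.lie_comm hm ht) (H.map₁₂ hm'))] at h

lemma isCent_lie_add (H : NormalLie e f k φ) {a b : A} (ha : InCorner e e a)
    (hb : InCorner f f b) : IsCent (⁅φ a, b⁆ + ⁅a, φ b⁆) := by
  have p := H.pair
  have haf : a * f = f * a := by rw [ha.right_eq_zero p.ef, ha.left_eq_zero p.fe]
  have hbf : b * f = f * b := by rw [hb.1, hb.2]
  have hA := H.map_comm haf
  have hB := H.map_comm hbf
  have c1 : ∀ x y : A, x * f = f * x → y * f = f * y → ⁅x, y⁆ * f = f * ⁅x, y⁆ := by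
    intro x y hx hy
    rw [Ring.lie_def, sub_mul, mul_sub, mul_assoc, hy, ← mul_assoc, hx, mul_assoc y, hx,
      ← mul_assoc y, hy, mul_assoc, mul_assoc]
  refine p.isCent_of_comm (by rw [add_mul, mul_add, c1 _ _ hA hbf, c1 _ _ haf hB]) fun m hm => ?_
  have h := H.tail_right a b m
  have hab : ⁅a, b⁆ = 0 := by
    rw [Ring.lie_def, ha.mul_eq_zero hb p.ef, hb.mul_eq_zero ha p.fe, sub_zero]
  have h0 : ∀ y : A, ⁅(0 : A), y⁆ = 0 := fun y => by rw [Ring.lie_def]; simp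
  rw [hab, h0, h0, adIter_zero_right, map_zero, add_zero,
    p.adIter₁₂ (p.lie_mem₁₂ (c1 _ _ hA hbf) hm), p.adIter₁₂ (p.lie_mem₁₂ (c1 _ _ haf hB) hm)] at h
  rw [← sub_eq_zero, h, Ring.lie_def _ m, Ring.lie_def _ m]
  noncomm_ring

lemma map_mem_corner_comm (H : NormalLie e f k φ) {a : A} (ha : InCorner e e a) {b : A}
    (hb : InCorner f f b) : φ a * b = b * φ a := by
  have p := H.pair
  have haf : a * f = f * a := by rw [ha.right_eq_zero p.ef, ha.left_eq_zero p.fe]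
  have hA := H.map_comm haf
  set c := f * φ a * f with hc
  have hcc : InCorner f f c := p.symm.corner₁₁ _
  have hlie : ∀ b, InCorner f f b → ⁅φ a, b⁆ = ⁅c, b⁆ := by
    intro b hb
    have h1 : φ a * b = c * b := by rw [hc, ← hA, mul_assoc _ f f, p.ff, mul_assoc, hb.1]
    have h2 : b * φ a = b * c := by rw [hc, mul_assoc f, hA, ← mul_assoc f f, p.ff, ← mul_assoc, hb.2]
    rw [Ring.lie_def, Ring.lie_def, h1, h2]
  have hcent : ∀ b, InCorner f f b → ∃ u, IsCent u ∧ ⁅c, b⁆ = u * f := by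
    intro b hb
    refine ⟨_, H.isCent_lie_add ha hb, ?_⟩
    have hbf : b * f = f * b := by rw [hb.1, hb.2]
    have hB := H.map_comm hbf
    rw [hlie b hb, add_mul, Ring.lie_def a, sub_mul, mul_assoc, hB, mul_assoc _ a f,
      ← mul_assoc a f, ha.right_eq_zero p.ef, Ring.lie_def, sub_mul, mul_assoc c, hb.2,
      mul_assoc b, hcc.2]
    simp
  obtain ⟨u, hu, hub⟩ := hcent b hb
  obtain ⟨v, hv, hvb⟩ := hcent (c * b) (hcc.mul hb)
  have h1 : ⁅c, c * b⁆ = c * ⁅c, b⁆ := by rw [Ring.lie_def, Ring.lie_def]; noncomm_ring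
  have h2 : ⁅c * ⁅c, b⁆, b⁆ = ⁅c, b⁆ * ⁅c, b⁆ + c * ⁅⁅c, b⁆, b⁆ := by
    simp only [Ring.lie_def]; noncomm_ring
  have hz : ∀ w, IsCent w → ⁅w * f, b⁆ = 0 := by
    intro w hw
    rw [Ring.lie_def, mul_assoc, hb.1, hw, hw f, ← mul_assoc, hb.2, sub_self]
  rw [← h1, hvb, hz v hv, hub, hz u hu, mul_zero, add_zero] at h2
  have hu0 : u = 0 := by
    have h3 : u * (u * f) = 0 := by
      rw [h2, mul_assoc, ← mul_assoc f u f, ← hu f, mul_assoc u f f, p.ff]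
    rcases p.cent_mul hu h3 with h4 | h4
    · exact h4
    · exact (p.cent_mul hu h4).resolve_right p.right_ne
  rw [← sub_eq_zero, ← Ring.lie_def, hlie b hb, hub, hu0, zero_mul]

end NormalLie

namespace PrimePair

variable {e f : A}

lemma comm₁₁ (h : PrimePair e f) {a : A} (ha : InCorner e e a) : a * f = f * a := by
  rw [ha.right_eq_zero h.ef, ha.left_eq_zero h.fe]

lemma cent_ext (h : PrimePair e f) {z w : A} (hz : IsCent z) (hw : IsCent w)
    (hzw : z * f = w * f) : z = w := by
  rw [← sub_eq_zero]
  refine (h.cent_mul (hz.sub hw) ?_).resolve_right h.right_ne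
  rw [sub_mul, hzw, sub_self]

/-- Elements of the two diagonal corners acting in the same way on `eAf` come from a central
element. -/
lemma exists_cent (h : PrimePair e f) {x y : A} (hx : x * f = f * x) (hy : y * f = f * y)
    (hxy : ∀ m, InCorner e f m → x * m = m * y) : ∃ z, IsCent z ∧ y * f = z * f := by
  have hx' := h.comm_symm hx
  refine ⟨x * e + y * f, h.isCent_of_comm ?_ fun m hm => ?_, ?_⟩
  · rw [add_mul, mul_add, mul_assoc, h.ef, mul_assoc, h.ff, hx', ← mul_assoc, h.fe, hy, ← mul_assoc,
      h.ff]
    simp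
  · rw [add_mul, mul_add, mul_assoc, hm.1, mul_assoc, hm.left_eq_zero h.fe, hx', ← mul_assoc,
      hm.right_eq_zero h.fe, ← mul_assoc, ← hxy m hm, mul_assoc x, hm.2]
    simp
  · rw [add_mul, mul_assoc, h.ef, mul_assoc, h.ff]
    simp

end PrimePair

namespace NormalLie

variable {e f : A} {k : ℕ} {φ : A →ₗ[R] A}

/-- The `fAf`-component of `φ x` comes from a central element. -/
def CentralTail (f : A) (φ : A →ₗ[R] A) (x : A) : Prop := ∃ z, IsCent z ∧ φ x * f = z * f

lemma map_mul₁₂ (H : NormalLie e f k φ) {a m : A} (ha : InCorner e e a) (hm : InCorner e f m) :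
    φ (a * m) = φ a * m - m * φ a + a * φ m := by
  have p := H.pair
  have h := H.map_lie (p.comm₁₁ ha) hm
  rwa [Ring.lie_def, hm.mul_eq_zero ha p.fe, sub_zero, Ring.lie_def, Ring.lie_def,
    (H.map₁₂ hm).mul_eq_zero ha p.fe, sub_zero] at h

lemma defect_mul (H : NormalLie e f k φ) {a a' m : A} (ha : InCorner e e a)
    (ha' : InCorner e e a') (hm : InCorner e f m) :
    (φ (a * a') - φ a * a' - a * φ a') * m =
      m * φ (a * a') - a' * m * φ a - a * m * φ a' := by
  have h1 := H.map_mul₁₂ (ha.mul ha') hm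
  rw [mul_assoc, H.map_mul₁₂ ha (ha'.mul hm), H.map_mul₁₂ ha' hm] at h1
  have h2 : φ (a * a') * m = φ a * (a' * m) - a' * m * φ a + a * (φ a' * m - m * φ a' + a' * φ m)
      - a * a' * φ m + m * φ (a * a') := by rw [h1]; abel
  rw [sub_mul, sub_mul, h2]
  noncomm_ring

lemma defect_comm (H : NormalLie e f k φ) {a a' : A} (ha : InCorner e e a)
    (ha' : InCorner e e a') :
    (φ (a * a') - φ a * a' - a * φ a') * f = f * (φ (a * a') - φ a * a' - a * φ a') := by
  have p := H.pair
  rw [sub_mul, sub_mul, mul_sub, mul_sub, H.map_comm (p.comm₁₁ (ha.mul ha')), mul_assoc,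
    p.comm₁₁ ha', ← mul_assoc, H.map_comm (p.comm₁₁ ha), mul_assoc a, H.map_comm (p.comm₁₁ ha'),
    ← mul_assoc a, p.comm₁₁ ha, mul_assoc, mul_assoc]

lemma mul_map_eq (H : NormalLie e f k φ) {a m z : A} (ha : InCorner e e a)
    (hm : InCorner e f m) (hz : IsCent z) (h : φ a * f = z * f) : m * φ a = z * m := by
  rw [← hm.2, mul_assoc, ← H.map_comm (H.pair.comm₁₁ ha), h, hz, ← mul_assoc, ← hz]

lemma centralTail_mul (H : NormalLie e f k φ) {a a' : A} (ha : InCorner e e a)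
    (ha' : InCorner e e a') (h : CentralTail f φ a) (h' : CentralTail f φ a') :
    CentralTail f φ (a * a') := by
  have p := H.pair
  obtain ⟨z, hz, hza⟩ := h
  obtain ⟨w, hw, hwa⟩ := h'
  refine p.exists_cent (x := (φ (a * a') - φ a * a' - a * φ a') + z * a' + w * a) ?_
    (H.map_comm (p.comm₁₁ (ha.mul ha'))) fun m hm => ?_
  · rw [add_mul, add_mul, mul_add, mul_add, H.defect_comm ha ha',
      hz.mul_comm_of_comm (p.comm₁₁ ha'), hw.mul_comm_of_comm (p.comm₁₁ ha)]
  · rw [add_mul, add_mul, H.defect_mul ha ha' hm, H.mul_map_eq ha (ha'.mul hm) hz hza,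
      H.mul_map_eq ha' (ha.mul hm) hw hwa, mul_assoc, mul_assoc]
    abel

lemma centralTail_lie (H : NormalLie e f k φ) {a a' : A} (ha : InCorner e e a)
    (ha' : InCorner e e a') : CentralTail f φ (a * a' - a' * a) := by
  have p := H.pair
  refine p.exists_cent
    (x := (φ (a * a') - φ a * a' - a * φ a') - (φ (a' * a) - φ a' * a - a' * φ a)) ?_
    (H.map_comm (p.comm₁₁ ((ha.mul ha').sub (ha'.mul ha)))) fun m hm => ?_
  · rw [sub_mul, mul_sub, H.defect_comm ha ha', H.defect_comm ha' ha]
  · rw [sub_mul, H.defect_mul ha ha' hm, H.defect_mul ha' ha hm, map_sub, mul_sub]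
    abel

lemma centralTail_idem (H : NormalLie e f k φ) {q : A} (hq : InCorner e e q) (hqq : q * q = q) :
    CentralTail f φ q := by
  have p := H.pair
  refine p.exists_cent (x := (e - q - q) * (φ (q * q) - φ q * q - q * φ q)) ?_
    (H.map_comm (p.comm₁₁ hq)) fun m hm => ?_
  · have h1 : InCorner e e (e - q - q) := (InCorner.sub ⟨p.ee, p.ee⟩ hq).sub hq
    rw [mul_assoc, H.defect_comm hq hq, ← mul_assoc, p.comm₁₁ h1, mul_assoc]
  · rw [mul_assoc, H.defect_mul hq hq hm, hqq]
    have : ∀ v, q * (q * v) = q * v := fun v => by rw [← mul_assoc, hqq]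
    have hem : ∀ v, e * (m * v) = m * v := fun v => by rw [← mul_assoc, hm.1]
    have heq : ∀ v, e * (q * v) = q * v := fun v => by rw [← mul_assoc, hq.1]
    simp only [sub_mul, mul_sub, mul_assoc, this, hem, heq]
    abel

lemma centralTail_of_generated (H : NormalLie e f k φ) (hS : CornerGenerated R e) {a : A}
    (ha : InCorner e e a) : CentralTail f φ a := by
  have p := H.pair
  have h1 := hS a
  rw [ha.1, ha.2] at h1
  clear ha
  suffices h : InCorner e e a ∧ CentralTail f φ a from h.2
  induction h1 using NonUnitalAlgebra.adjoin_induction with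
  | mem x hx =>
    rcases hx with ⟨hx, hxx⟩ | ⟨b, c, rfl⟩
    · have hxc : InCorner e e x := by rw [hx]; exact p.corner₁₁ x
      exact ⟨hxc, H.centralTail_idem hxc hxx⟩
    · have hb := p.corner₁₁ b
      have hc := p.corner₁₁ c
      exact ⟨(hb.mul hc).sub (hc.mul hb), H.centralTail_lie hb hc⟩
  | add x y _ _ hx hy =>
    obtain ⟨hx, z, hz, hzx⟩ := hx
    obtain ⟨hy, w, hw, hwy⟩ := hy
    exact ⟨hx.add hy, z + w, hz.add hw, by rw [map_add, add_mul, hzx, hwy, add_mul]⟩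
  | zero => exact ⟨⟨mul_zero e, zero_mul e⟩, 0, isCent_zero, by simp⟩
  | mul x y _ _ hx hy => exact ⟨hx.1.mul hy.1, H.centralTail_mul hx.1 hy.1 hx.2 hy.2⟩
  | smul r x _ hx =>
    obtain ⟨hx, z, hz, hzx⟩ := hx
    exact ⟨⟨by rw [mul_smul_comm, hx.1], by rw [smul_mul_assoc, hx.2]⟩, r • z, hz.smul r,
      by rw [map_smul, smul_mul_assoc, hzx, smul_mul_assoc]⟩

lemma centralTail_of_center (H : NormalLie e f k φ)
    (hZ : cornerCenter f = (fun z : A => f * z * f) '' centerSet A) {a : A}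
    (ha : InCorner e e a) : CentralTail f φ a := by
  have p := H.pair
  have hA := H.map_comm (p.comm₁₁ ha)
  have h1 : φ a * f ∈ cornerCenter f := by
    constructor
    · rw [hA, ← mul_assoc, p.ff, mul_assoc, hA, ← mul_assoc, p.ff]
    · intro y
      have hy := p.symm.corner₁₁ y
      rw [mul_assoc, hy.1, H.map_mem_corner_comm ha hy, ← mul_assoc, mul_assoc _ (φ a) f, hA,
        ← mul_assoc, hy.2, ← H.map_mem_corner_comm ha hy, H.map_mem_corner_comm ha hy]
  rw [hZ] at h1
  obtain ⟨z, hz, hza⟩ := h1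
  exact ⟨z, hz, by rw [← hza]; simp only; rw [← hz f, mul_assoc, p.ff]⟩

end NormalLie

/-- A linear map respecting a Peirce decomposition and satisfying the Lie identities involving
the off-diagonal components. -/
structure PeirceLie (e f : A) (d : A →ₗ[R] A) : Prop where
  pair : PrimePair e f
  two : TorsionFreeAt A 2
  map₁₁ : ∀ a, InCorner e e a → InCorner e e (d a)
  map₂₂ : ∀ a, InCorner f f a → InCorner f f (d a)
  map₁₂ : ∀ a, InCorner e f a → InCorner e f (d a)
  map₂₁ : ∀ a, InCorner f e a → InCorner f e (d a)
  lie₁₂ : ∀ x m, x * f = f * x → InCorner e f m → d ⁅x, m⁆ = ⁅d x, m⁆ + ⁅x, d m⁆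
  lie₂₁ : ∀ x m, x * e = e * x → InCorner f e m → d ⁅x, m⁆ = ⁅d x, m⁆ + ⁅x, d m⁆
  triple₁₂ : ∀ m t m', InCorner e f m → InCorner f e t → InCorner e f m' →
    d ⁅⁅m, t⁆, m'⁆ = ⁅⁅d m, t⁆, m'⁆ + ⁅⁅m, d t⁆, m'⁆ + ⁅⁅m, t⁆, d m'⁆
  triple₂₁ : ∀ m t m', InCorner f e m → InCorner e f t → InCorner f e m' →
    d ⁅⁅m, t⁆, m'⁆ = ⁅⁅d m, t⁆, m'⁆ + ⁅⁅m, d t⁆, m'⁆ + ⁅⁅m, t⁆, d m'⁆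

namespace PeirceLie

variable {e f : A} {d : A →ₗ[R] A}

lemma symm (H : PeirceLie e f d) : PeirceLie f e d :=
  ⟨H.pair.symm, H.two, H.map₂₂, H.map₁₁, H.map₂₁, H.map₁₂, H.lie₂₁, H.lie₁₂, H.triple₂₁,
    H.triple₁₂⟩

lemma mul₁₁₁₂ (H : PeirceLie e f d) {a m : A} (ha : InCorner e e a) (hm : InCorner e f m) :
    d (a * m) = d a * m + a * d m := by
  have p := H.pair
  have h := H.lie₁₂ a m (p.comm₁₁ ha) hm
  rwa [Ring.lie_def, Ring.lie_def, Ring.lie_def, hm.mul_eq_zero ha p.fe,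
    hm.mul_eq_zero (H.map₁₁ a ha) p.fe, (H.map₁₂ m hm).mul_eq_zero ha p.fe, sub_zero, sub_zero,
    sub_zero] at h

lemma mul₁₂₂₂ (H : PeirceLie e f d) {b m : A} (hb : InCorner f f b) (hm : InCorner e f m) :
    d (m * b) = d m * b + m * d b := by
  have p := H.pair
  have h := H.lie₁₂ b m (by rw [hb.1, hb.2]) hm
  rw [Ring.lie_def, Ring.lie_def, Ring.lie_def, hb.mul_eq_zero hm p.fe,
    (H.map₂₂ b hb).mul_eq_zero hm p.fe, hb.mul_eq_zero (H.map₁₂ m hm) p.fe, zero_sub, zero_sub,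
    zero_sub, map_neg] at h
  rw [← neg_inj, h]
  abel

lemma mul₁₁₁₁ (H : PeirceLie e f d) {a b : A} (ha : InCorner e e a) (hb : InCorner e e b) :
    d (a * b) = d a * b + a * d b := by
  have p := H.pair
  have h1 : (d (a * b) - (d a * b + a * d b)) * e = 0 := p.loyal_left fun m hm => by
    have h1 := H.mul₁₁₁₂ (ha.mul hb) hm
    rw [mul_assoc, H.mul₁₁₁₂ ha (hb.mul hm), H.mul₁₁₁₂ hb hm] at h1
    rw [sub_mul, sub_eq_zero, ← add_left_inj (a * b * d m), ← h1]
    noncomm_ring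
  rw [← sub_eq_zero, ← h1]
  exact ((H.map₁₁ _ (ha.mul hb)).sub
    (((H.map₁₁ a ha).mul hb).add (ha.mul (H.map₁₁ b hb)))).2.symm

lemma mul₁₂₂₁ (H : PeirceLie e f d) {m t : A} (hm : InCorner e f m) (ht : InCorner f e t) :
    d (m * t) = d m * t + m * d t := by
  have p := H.pair
  have hdm := H.map₁₂ m hm
  have hdt := H.map₂₁ t ht
  set D := d (m * t) - d m * t - m * d t with hD
  set D' := d (t * m) - t * d m - d t * m with hD'
  have hDc : InCorner e e D := ((H.map₁₁ _ (hm.mul ht)).sub (hdm.mul ht)).sub (hm.mul hdt)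
  have hDc' : InCorner f f D' := ((H.map₂₂ _ (ht.mul hm)).sub (ht.mul hdm)).sub (hdt.mul hm)
  have h1 : ∀ m', InCorner e f m' → D * m' = -(m' * D') := by
    intro m' hm'
    have hdm' := H.map₁₂ m' hm'
    have key : ∀ u v w : A, InCorner e f u → InCorner f e v → InCorner e f w →
        ⁅⁅u, v⁆, w⁆ = u * v * w + w * (v * u) := by
      intro u v w hu hv hw
      rw [Ring.lie_def, Ring.lie_def, sub_mul, mul_sub, (hv.mul hu).mul_eq_zero hw p.fe,
        hw.mul_eq_zero (hu.mul hv) p.fe]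
      abel
    have h2 := H.triple₁₂ m t m' hm ht hm'
    rw [key _ _ _ hm ht hm', key _ _ _ hdm ht hm', key _ _ _ hm hdt hm', key _ _ _ hm ht hdm',
      map_add, H.mul₁₁₁₂ (hm.mul ht) hm', H.mul₁₂₂₂ (ht.mul hm) hm', ← sub_eq_zero] at h2
    rw [← sub_eq_zero, ← h2, hD, hD']
    noncomm_ring
  have h2 : D * m = m * D' := by
    have h3 := H.mul₁₁₁₂ (hm.mul ht) hm
    rw [mul_assoc, H.mul₁₂₂₂ (ht.mul hm) hm, ← sub_eq_zero] at h3
    rw [← sub_eq_zero, ← neg_eq_zero, ← h3, hD, hD']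
    noncomm_ring
  have h3 : D * m = 0 := by
    refine H.two.eq_zero ?_
    nth_rewrite 1 [h1 m hm]
    rw [h2, neg_add_cancel]
  have hc : IsCent (D - D') := by
    refine p.isCent_of_comm ?_ fun m' hm' => ?_
    · rw [sub_mul, mul_sub, p.comm₁₁ hDc, hDc'.1, hDc'.2]
    · rw [sub_mul, mul_sub, hDc'.mul_eq_zero hm' p.fe, hm'.mul_eq_zero hDc p.fe, h1 m' hm']
      abel
  have hD0 : D = 0 := by
    rcases p.cent_mul hc (x := m) (by
      rw [sub_mul, h3, hDc'.mul_eq_zero hm p.fe, sub_zero]) with h4 | h4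
    · rw [← hDc.2, sub_eq_zero.1 h4, hDc'.right_eq_zero p.fe]
    · rw [hD, h4]; simp
  rw [hD, sub_sub, sub_eq_zero] at hD0
  exact hD0

lemma isDeriv (H : PeirceLie e f d) : IsDeriv d := by
  have p := H.pair
  have hS := H.symm
  intro x y
  have hadd : ∀ u v w : A, d (u * w) = d u * w + u * d w → d (v * w) = d v * w + v * d w →
      d ((u + v) * w) = d (u + v) * w + (u + v) * d w := by
    intro u v w h1 h2
    rw [add_mul, map_add, h1, h2, map_add]; noncomm_ring
  have hadd' : ∀ w u v : A, d (w * u) = d w * u + w * d u → d (w * v) = d w * v + w * d v →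
      d (w * (u + v)) = d w * (u + v) + w * d (u + v) := by
    intro w u v h1 h2
    rw [mul_add, map_add, h1, h2, map_add]; noncomm_ring
  have hz : ∀ {g h i j u v : A}, InCorner g h u → InCorner i j v → InCorner g h (d u) →
      InCorner i j (d v) → h * i = 0 → d (u * v) = d u * v + u * d v := by
    intro g h i j u v hu hv hdu hdv hi
    rw [hu.mul_eq_zero hv hi, hdu.mul_eq_zero hv hi, hu.mul_eq_zero hdv hi, map_zero, add_zero]
  have x1 := p.corner₁₁ x
  have x2 := p.corner₁₂ x
  have x3 := p.symm.corner₁₂ x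
  have x4 := p.symm.corner₁₁ x
  have y1 := p.corner₁₁ y
  have y2 := p.corner₁₂ y
  have y3 := p.symm.corner₁₂ y
  have y4 := p.symm.corner₁₁ y
  rw [p.decomp x, p.decomp y]
  refine hadd _ _ _ (hadd _ _ _ (hadd _ _ _ ?_ ?_) ?_) ?_ <;>
    refine hadd' _ _ _ (hadd' _ _ _ (hadd' _ _ _ ?_ ?_) ?_) ?_
  · exact H.mul₁₁₁₁ x1 y1
  · exact H.mul₁₁₁₂ x1 y2
  · exact hz x1 y3 (H.map₁₁ _ x1) (H.map₂₁ _ y3) p.ef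
  · exact hz x1 y4 (H.map₁₁ _ x1) (H.map₂₂ _ y4) p.ef
  · exact hz x2 y1 (H.map₁₂ _ x2) (H.map₁₁ _ y1) p.fe
  · exact hz x2 y2 (H.map₁₂ _ x2) (H.map₁₂ _ y2) p.fe
  · exact H.mul₁₂₂₁ x2 y3
  · exact H.mul₁₂₂₂ y4 x2
  · exact hS.mul₁₂₂₂ y1 x3
  · exact hS.mul₁₂₂₁ x3 y2
  · exact hz x3 y3 (H.map₂₁ _ x3) (H.map₂₁ _ y3) p.ef
  · exact hz x3 y4 (H.map₂₁ _ x3) (H.map₂₂ _ y4) p.ef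
  · exact hz x4 y1 (H.map₂₂ _ x4) (H.map₁₁ _ y1) p.fe
  · exact hz x4 y2 (H.map₂₂ _ x4) (H.map₁₂ _ y2) p.fe
  · exact hS.mul₁₁₁₂ x4 y3
  · exact hS.mul₁₁₁₁ x4 y4

end PeirceLie

namespace NormalLie

variable {e f : A} {k : ℕ} {φ : A →ₗ[R] A}

lemma exists_centralPart (p : PrimePair e f) (h : ∀ x, CentralTail f φ (e * x * e)) :
    ∃ γ : A →ₗ[R] A, (∀ x, IsCent (γ x)) ∧ ∀ x, φ (e * x * e) * f = γ x * f := by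
  choose z hz hzx using h
  refine ⟨⟨⟨z, fun x y => ?_⟩, fun r x => ?_⟩, hz, hzx⟩
  · refine p.cent_ext (hz _) ((hz _).add (hz _)) ?_
    rw [← hzx, add_mul, ← hzx, ← hzx, mul_add, add_mul, map_add, add_mul]
  · refine p.cent_ext (hz _) ((hz _).smul _) ?_
    rw [← hzx, RingHom.id_apply, smul_mul_assoc, ← hzx, mul_smul_comm, smul_mul_assoc, map_smul,
      smul_mul_assoc]

lemma centralPart_eq_zero (p : PrimePair e f) {γ : A →ₗ[R] A} (hγ : ∀ x, IsCent (γ x))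
    (hφ : ∀ x, φ (e * x * e) * f = γ x * f) {x : A} (hx : e * x * e = 0) : γ x = 0 :=
  p.cent_ext (hγ x) isCent_zero (by rw [← hφ, hx, map_zero])

lemma map₁₁_sub (H : NormalLie e f k φ) {a z : A} (ha : InCorner e e a) (hz : IsCent z)
    (h : φ a * f = z * f) : InCorner e e (φ a - z) := by
  have p := H.pair
  have h1 : (φ a - z) * f = 0 := by rw [sub_mul, h, sub_self]
  have h2 : f * (φ a - z) = 0 := by rw [mul_sub, ← H.map_comm (p.comm₁₁ ha), h, hz, sub_self]
  constructor
  · nth_rewrite 2 [← one_mul (φ a - z)]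
    rw [← p.sum, add_mul, h2, add_zero]
  · nth_rewrite 2 [← mul_one (φ a - z)]
    rw [← p.sum, mul_add, h1, add_zero]

lemma sub_lie (H : NormalLie e f k φ) {γ : A →ₗ[R] A} (hγ : ∀ x, IsCent (γ x))
    (h0 : ∀ m, InCorner e f m → γ m = 0) {x m : A} (hx : x * f = f * x) (hm : InCorner e f m) :
    (φ - γ) ⁅x, m⁆ = ⁅(φ - γ) x, m⁆ + ⁅x, (φ - γ) m⁆ := by
  have h1 : ⁅φ x - γ x, m⁆ = ⁅φ x, m⁆ := by
    rw [Ring.lie_def, Ring.lie_def, sub_mul, mul_sub, hγ x m]; abel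
  simp only [LinearMap.sub_apply]
  rw [h0 m hm, h0 _ (H.pair.lie_mem₁₂ hx hm), h1, sub_zero, sub_zero, H.map_lie hx hm]

lemma sub_triple (H : NormalLie e f k φ) {γ : A →ₗ[R] A}
    (h0 : ∀ m, InCorner e f m → γ m = 0) (h0' : ∀ m, InCorner f e m → γ m = 0) {m t m' : A}
    (hm : InCorner e f m) (ht : InCorner f e t) (hm' : InCorner e f m') :
    (φ - γ) ⁅⁅m, t⁆, m'⁆ =
      ⁅⁅(φ - γ) m, t⁆, m'⁆ + ⁅⁅m, (φ - γ) t⁆, m'⁆ + ⁅⁅m, t⁆, (φ - γ) m'⁆ := by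
  simp only [LinearMap.sub_apply]
  rw [h0 m hm, h0 m' hm', h0' t ht, h0 _ (H.pair.lie_mem₁₂ (H.lie_comm hm ht) hm'), sub_zero,
    sub_zero, sub_zero, sub_zero, H.map_lie_lie hm ht hm']

lemma exists_isDeriv (H : NormalLie e f k φ) (h₁ : ∀ a, InCorner e e a → CentralTail f φ a)
    (h₂ : ∀ b, InCorner f f b → CentralTail e φ b) :
    ∃ d : A →ₗ[R] A, IsDeriv d ∧ ∀ x, IsCent ((φ - d) x) := by
  have p := H.pair
  have hS := H.symm
  obtain ⟨γ₁, hc₁, hγ₁⟩ := exists_centralPart p fun x => h₁ _ (p.corner₁₁ x)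
  obtain ⟨γ₂, hc₂, hγ₂⟩ := exists_centralPart p.symm fun x => h₂ _ (p.symm.corner₁₁ x)
  have hc : ∀ x, IsCent ((γ₁ + γ₂) x) := fun x => (hc₁ x).add (hc₂ x)
  have z₁ : ∀ {x}, e * x * e = 0 → γ₁ x = 0 := fun hx => centralPart_eq_zero p hc₁ hγ₁ hx
  have z₂ : ∀ {x}, f * x * f = 0 → γ₂ x = 0 := fun hx => centralPart_eq_zero p.symm hc₂ hγ₂ hx
  have h12 : ∀ m, InCorner e f m → (γ₁ + γ₂) m = 0 := fun m hm => by
    rw [LinearMap.add_apply, z₁ (by rw [hm.1, hm.right_eq_zero p.fe]),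
      z₂ (by rw [hm.left_eq_zero p.fe, zero_mul]), add_zero]
  have h21 : ∀ m, InCorner f e m → (γ₁ + γ₂) m = 0 := fun m hm => by
    rw [LinearMap.add_apply, z₁ (by rw [hm.left_eq_zero p.ef, zero_mul]),
      z₂ (by rw [hm.1, hm.right_eq_zero p.ef]), add_zero]
  refine ⟨φ - (γ₁ + γ₂), PeirceLie.isDeriv (e := e) (f := f) ?_, fun x => ?_⟩
  · refine ⟨p, H.two, fun a ha => ?_, fun a ha => ?_, fun m hm => ?_, fun m hm => ?_,
      fun _ _ => H.sub_lie hc h12, fun _ _ => hS.sub_lie hc h21, fun _ _ _ => H.sub_triple h12 h21,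
      fun _ _ _ => hS.sub_triple h21 h12⟩
    · rw [LinearMap.sub_apply, LinearMap.add_apply, z₂ (by rw [ha.left_eq_zero p.fe, zero_mul]),
        add_zero]
      refine H.map₁₁_sub ha (hc₁ a) ?_
      rw [← hγ₁, ha.1, ha.2]
    · rw [LinearMap.sub_apply, LinearMap.add_apply, z₁ (by rw [ha.left_eq_zero p.ef, zero_mul]),
        zero_add]
      refine hS.map₁₁_sub ha (hc₂ a) ?_
      rw [← hγ₂, ha.1, ha.2]
    · rw [LinearMap.sub_apply, h12 m hm, sub_zero]
      exact H.map₁₂ hm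
    · rw [LinearMap.sub_apply, h21 m hm, sub_zero]
      exact hS.map₁₂ hm
  · rw [sub_sub_cancel]
    exact hc x

end NormalLie

/-- The inner derivation `x ↦ [x, u]`. -/
def innerDeriv (R : Type*) {A : Type*} [CommRing R] [Ring A] [Algebra R A] (u : A) : A →ₗ[R] A :=
  LinearMap.mulRight R u - LinearMap.mulLeft R u

lemma innerDeriv_apply (u x : A) : innerDeriv R u x = x * u - u * x := rfl

lemma isDeriv_innerDeriv (u : A) : IsDeriv (innerDeriv R u) := fun x y => by
  simp only [innerDeriv_apply]; noncomm_ring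

lemma IsLieNDeriv.two_to_three {φ : A →ₗ[R] A} (h : IsLieNDeriv 2 φ) : IsLieNDeriv 3 φ := by
  refine isLieNDeriv_of_lie (fun a b => ?_) (by omega)
  have h1 := h (fun i => if i = 0 then a else b)
  simp [Finset.sum_range_succ, pCom, Ring.lie_def] at h1 ⊢
  rw [h1]
  abel

lemma PrimePair.exists_isDeriv {e f : A} {k : ℕ} {φ : A →ₗ[R] A} (p : PrimePair e f)
    (h2 : TorsionFreeAt A 2) (hk : TorsionFreeAt A (k + 2)) (hφ : IsLieNDeriv (k + 3) φ)
    (h₁ : CornerGenerated R e ∨ cornerCenter f = (fun z : A => f * z * f) '' centerSet A)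
    (h₂ : CornerGenerated R f ∨ cornerCenter e = (fun z : A => e * z * e) '' centerSet A) :
    ∃ d : A →ₗ[R] A, IsDeriv d ∧ ∀ x, IsCent ((φ - d) x) := by
  set u := f * φ f * e - e * φ f * f with hu
  have hin := isDeriv_innerDeriv (R := R) u
  have hψ := hφ.sub (isLieNDeriv_of_lie hin.lie (n := k + 3) (by omega))
  set ψ := φ - innerDeriv R u with hψd
  have hψf : ψ f * f = f * ψ f := by
    have : ψ f = φ f - (f * φ f * e + e * φ f * f) := by
      rw [hψd, LinearMap.sub_apply, innerDeriv_apply, hu]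
      simp only [mul_sub, sub_mul, mul_assoc, mul_reassoc p.fe, mul_reassoc p.ff, p.ef, p.ff]
      simp
    refine p.comm_of_parts ?_ ?_ <;> rw [this] <;>
      simp only [mul_sub, sub_mul, mul_add, add_mul, mul_assoc, mul_reassoc p.fe, mul_reassoc p.ff,
        mul_reassoc p.ef, mul_reassoc p.ee, p.ef, p.ff, p.fe, p.ee] <;> simp
  have hcf := p.isCent_map_right hψ hk hψf
  have hce : IsCent (ψ e) := by
    have : ψ e = ψ 1 - ψ f := by rw [← p.sum, map_add, add_sub_cancel_right]
    rw [this]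
    exact (p.isCent_map_one hψ).sub hcf
  have H : NormalLie e f k ψ := ⟨p, h2, hce, hcf, hψ.tailLie hce, hψ.tailLie hcf⟩
  obtain ⟨d, hd, hc⟩ := H.exists_isDeriv
    (fun a ha => h₁.elim (fun h => H.centralTail_of_generated h ha)
      fun h => H.centralTail_of_center h ha)
    (fun b hb => h₂.elim (fun h => H.symm.centralTail_of_generated h hb)
      fun h => H.symm.centralTail_of_center h hb)
  refine ⟨d + innerDeriv R u, fun x y => ?_, fun x => ?_⟩
  · simp only [LinearMap.add_apply, hd x y, hin x y]; noncomm_ring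
  · rw [add_comm, ← sub_sub]
    exact hc x

end PeirceDecomposition

theorem stmt_18 (R : Type*) [CommRing R] (A : Type*) [Ring A] [Algebra R A]
    (hprime : ∀ a b : A, (∀ x : A, a * x * b = 0) → a = 0 ∨ b = 0)
    (n : ℕ) (hn : 2 ≤ n)
    (h2 : TorsionFreeAt A 2) (hn1 : TorsionFreeAt A (n - 1))
    (e : A) (he : e * e = e) (he0 : e ≠ 0) (he1 : e ≠ 1)
    (hyp1 :
      (CornerGenerated R e ∧ CornerGenerated R (1 - e)) ∨
      (CornerGenerated R e ∧
        cornerCenter e = (fun z : A => e * z * e) '' centerSet A) ∨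
      (CornerGenerated R (1 - e) ∧
        cornerCenter (1 - e) = (fun z : A => (1 - e) * z * (1 - e)) '' centerSet A) ∨
      (cornerCenter e = (fun z : A => e * z * e) '' centerSet A ∧
        cornerCenter (1 - e) = (fun z : A => (1 - e) * z * (1 - e)) '' centerSet A))
    (hyp2 :
      (¬ (∀ a b : A, (e * a * e) * (e * b * e) = (e * b * e) * (e * a * e)) ∨
       ¬ (∀ a b : A,
          ((1 - e) * a * (1 - e)) * ((1 - e) * b * (1 - e)) =
            ((1 - e) * b * (1 - e)) * ((1 - e) * a * (1 - e)))) ∨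
      (NoNonzeroCentralIdeal R A e ∨ NoNonzeroCentralIdeal R A (1 - e)) ∨
      (∃ m₀ : A, m₀ = e * m₀ * (1 - e) ∧
        centerSet A = {x : A | ∃ a b : A,
          (∃ z : A, IsCent z ∧ a = e * z * e) ∧
          (∃ z : A, IsCent z ∧ b = (1 - e) * z * (1 - e)) ∧
          a * m₀ = m₀ * b ∧ x = a + b}) ∨
      (∃ t₀ : A, t₀ = (1 - e) * t₀ * e ∧
        centerSet A = {x : A | ∃ a b : A,
          (∃ z : A, IsCent z ∧ a = e * z * e) ∧
          (∃ z : A, IsCent z ∧ b = (1 - e) * z * (1 - e)) ∧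
          t₀ * a = b * t₀ ∧ x = a + b}) ∨
      (∀ m t : A, (e * m * (1 - e)) * ((1 - e) * t * e) = 0 ∧
        ((1 - e) * t * e) * (e * m * (1 - e)) = 0)) :
    ∀ φ : A →ₗ[R] A, IsLieNDeriv n φ → IsStandardLieNDeriv n φ := by
  intro φ hφ
  have p : PrimePair e (1 - e) :=
    { prime := hprime
      left_ne := he0
      right_ne := fun h => he1 (sub_eq_zero.1 h).symm
      ee := he
      ff := by rw [mul_sub, sub_mul, sub_mul, he]; simp
      ef := by rw [mul_sub, he]; simp
      fe := by rw [sub_mul, he]; simp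
      sum := by abel }
  have h₁ : CornerGenerated R e ∨
      cornerCenter (1 - e) = (fun z : A => (1 - e) * z * (1 - e)) '' centerSet A := by tauto
  have h₂ : CornerGenerated R (1 - e) ∨
      cornerCenter e = (fun z : A => e * z * e) '' centerSet A := by tauto
  obtain ⟨d, hd, hc⟩ : ∃ d : A →ₗ[R] A, IsDeriv d ∧ ∀ x, IsCent ((φ - d) x) := by
    rcases Nat.eq_or_lt_of_le hn with rfl | hn3
    · exact p.exists_isDeriv (k := 0) h2 h2 hφ.two_to_three h₁ h₂
    · obtain ⟨k, rfl⟩ : ∃ k, n = k + 3 := ⟨n - 3, by omega⟩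
      exact p.exists_isDeriv h2 hn1 hφ h₁ h₂
  refine ⟨d, φ - d, hd, hc, fun x => ?_, by abel⟩
  rw [hφ.sub (isLieNDeriv_of_lie hd.lie (by omega)) x]
  refine Finset.sum_eq_zero fun i hi => ?_
  refine pCom_eq_zero (i := i) ?_ (by simp at hi; omega) (by omega)
  rw [Function.update_self]
  exact hc _
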